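/- arXiv:2404.01022 — 14 statements merged into one kernel-verified Lean document; each statement's English description precedes it below -/
import Mathlib

section
/- Let G be a finite simple undirected graph with edge weights w: E(G) → [0,∞), let k ≥ 1, let t₁,…,t_k be distinct vertices of G (the terminals), and let →G, G', q be as in the subdivision construction. Define p: V(G') × {1,…,k} → [0,∞] by p(t_j, i) = ∞ whenever i ≠ j, and p(x, i) = 0 otherwise. Then for every r ∈ [0,∞): there exists a partition (V₁,…,V_k) of V(G) with t_i ∈ V_i for every i such that the total weight Σ w({v,u}) over edges {v,u} of G whose endpoints lie in different parts is at most r, if and only if there exists an assignment f: V(G') → {1,…,k} with Σ_{x∈V(G')} p(x, f(x)) + Δ(f,q,G') ≤ r. -/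
open scoped Classical
open Finset

noncomputable section

/-- Transfer cost `Δ(f, q, G)` of an assignment `f` of the vertices of a digraph with
arc relation `A` to `k` machines. -/
def transferCost {V : Type*} [Fintype V] (A : V → V → Prop) (k : ℕ)
    (f : V → Fin k) (q : V → ENNReal) : ENNReal :=
  ∑ i : Fin k, ∑ v ∈ Finset.univ.filter (fun v => f v = i),
    ∑ j ∈ Finset.univ.filter (fun j => j ≠ i),
      if ∃ u, A v u ∧ f u = j then q v else 0

/-- Vertices of the subdivided DAG `G'`: original vertices together with one
subdivision vertex `a(v,u)` for every arc `(v,u)` of `→G` (the orientation of `G`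
from smaller to larger endpoint). -/
abbrev SubVertex {V : Type*} (G : SimpleGraph V) [LinearOrder V] :=
  V ⊕ {p : V × V // G.Adj p.1 p.2 ∧ p.1 < p.2}

/-- Arcs of `G'`: `(v, a(v,u))` and `(a(v,u), u)` for every arc `(v,u)` of `→G`. -/
def subArc {V : Type*} (G : SimpleGraph V) [LinearOrder V] :
    SubVertex G → SubVertex G → Prop
  | Sum.inl v, Sum.inr a => a.1.1 = v
  | Sum.inr a, Sum.inl u => a.1.2 = u
  | _, _ => False

/-- The function `q` on `V(G')`: `∞` on original vertices, `w({v,u})` on `a(v,u)`. -/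
def subQ {V : Type*} (G : SimpleGraph V) [LinearOrder V] (w : Sym2 V → NNReal) :
    SubVertex G → ENNReal
  | Sum.inl _ => ⊤
  | Sum.inr a => (w s(a.1.1, a.1.2) : ENNReal)

/-- The function `p` on `V(G') × [k]`: `p(t_j, i) = ∞` whenever `i ≠ j`, and `0` otherwise. -/
def subP {V : Type*} (G : SimpleGraph V) [LinearOrder V] {k : ℕ} (t : Fin k → V) :
    SubVertex G → Fin k → ENNReal :=
  fun x i => match x with
    | Sum.inl v => if ∃ j : Fin k, t j = v ∧ j ≠ i then ⊤ else 0
    | Sum.inr _ => 0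

theorem transferCost_eq_sum {V : Type*} [Fintype V] (A : V → V → Prop) (k : ℕ)
    (f : V → Fin k) (q : V → ENNReal) :
    transferCost A k f q =
      ∑ v, ∑ j ∈ univ.filter (fun j => j ≠ f v), if ∃ u, A v u ∧ f u = j then q v else 0 := by
  unfold transferCost
  rw [← Finset.sum_fiberwise univ f]
  refine Finset.sum_congr rfl fun i _ => Finset.sum_congr rfl fun v hv => ?_
  rw [(Finset.mem_filter.mp hv).2]

section Subdivision

variable {V : Type*} (G : SimpleGraph V) [LinearOrder V]

theorem exists_subArc_inr_iff (a : {p : V × V // G.Adj p.1 p.2 ∧ p.1 < p.2})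
    (P : SubVertex G → Prop) :
    (∃ u, subArc G (Sum.inr a) u ∧ P u) ↔ P (Sum.inl a.1.2) := by
  constructor
  · rintro ⟨u | b, h, hP⟩
    · exact (show a.1.2 = u from h) ▸ hP
    · exact h.elim
  · exact fun h => ⟨Sum.inl a.1.2, rfl, h⟩

/-- The total weight of the edges cut by `g`, as a sum over the arcs of the orientation. -/
theorem sum_cut_eq_sum_arcs [Fintype V] {k : ℕ} (w : Sym2 V → NNReal) (g : V → Fin k) :
    (∑ v : V, ∑ u : V,
        if G.Adj v u ∧ v < u ∧ g v ≠ g u then (w s(v, u) : ENNReal) else 0) =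
      ∑ a : {p : V × V // G.Adj p.1 p.2 ∧ p.1 < p.2},
        if g a.1.1 ≠ g a.1.2 then (w s(a.1.1, a.1.2) : ENNReal) else 0 := by
  rw [← Fintype.sum_prod_type', ← Finset.sum_subtype
    (univ.filter fun p : V × V => G.Adj p.1 p.2 ∧ p.1 < p.2) (by simp)
    (fun p : V × V => if g p.1 ≠ g p.2 then (w s(p.1, p.2) : ENNReal) else 0),
    Finset.sum_filter]
  refine Finset.sum_congr rfl fun p _ => ?_
  by_cases h : G.Adj p.1 p.2 <;> by_cases h' : p.1 < p.2 <;> simp [h, h']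

/-- The transfer cost in the subdivided graph splits into the costs of the original vertices
and of the subdivision vertices, the latter having a single out-neighbor each. -/
theorem transferCost_subArc [Fintype V] {k : ℕ} (w : Sym2 V → NNReal)
    (f : SubVertex G → Fin k) :
    transferCost (subArc G) k f (subQ G w) =
      (∑ v : V, ∑ j ∈ univ.filter (fun j => j ≠ f (Sum.inl v)),
        if ∃ u, subArc G (Sum.inl v) u ∧ f u = j then ⊤ else 0) +
      ∑ a : {p : V × V // G.Adj p.1 p.2 ∧ p.1 < p.2},
        if f (Sum.inr a) ≠ f (Sum.inl a.1.2) then (w s(a.1.1, a.1.2) : ENNReal) else 0 := by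
  rw [transferCost_eq_sum, Fintype.sum_sum_type]
  congr 1
  refine Finset.sum_congr rfl fun a _ => ?_
  simp only [exists_subArc_inr_iff G a (fun u => f u = _), Finset.sum_ite_eq, Finset.mem_filter,
    Finset.mem_univ, true_and, subQ, ne_comm]

end Subdivision

theorem stmt0 {V : Type*} [Fintype V] [LinearOrder V] (G : SimpleGraph V)
    (w : Sym2 V → NNReal) (k : ℕ) (hk : 1 ≤ k) (t : Fin k → V)
    (ht : Function.Injective t) (r : NNReal) :
    (∃ g : V → Fin k, (∀ i, g (t i) = i) ∧
      (∑ v : V, ∑ u : V,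
        if G.Adj v u ∧ v < u ∧ g v ≠ g u then (w s(v, u) : ENNReal) else 0) ≤ (r : ENNReal))
    ↔
    (∃ f : SubVertex G → Fin k,
      (∑ x : SubVertex G, subP G t x (f x))
        + transferCost (subArc G) k f (subQ G w) ≤ (r : ENNReal)) := by
  constructor
  · rintro ⟨g, hg, hcut⟩
    refine ⟨Sum.elim g fun a => g a.1.1, ?_⟩
    rw [sum_cut_eq_sum_arcs] at hcut
    have hP : ∑ x : SubVertex G, subP G t x (Sum.elim g (fun a => g a.1.1) x) = 0 := by
      refine Finset.sum_eq_zero fun x _ => ?_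
      rcases x with v | a
      · refine if_neg ?_
        rintro ⟨j, rfl, hj⟩
        exact hj (hg j).symm
      · rfl
    rw [hP, zero_add, transferCost_subArc, Finset.sum_eq_zero, zero_add]
    · exact hcut
    · refine fun v _ => Finset.sum_eq_zero fun j hj => if_neg ?_
      rintro ⟨u | a, hu, hf⟩
      · exact hu
      · obtain rfl : a.1.1 = v := hu
        exact (Finset.mem_filter.mp hj).2 hf.symm
  · rintro ⟨f, hf⟩
    have hfin := ne_top_of_le_ne_top ENNReal.coe_ne_top hf
    rw [transferCost_subArc] at hf hfin
    have hP := (ENNReal.add_ne_top.mp hfin).1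
    have hQ := (ENNReal.add_ne_top.mp (ENNReal.add_ne_top.mp hfin).2).1
    have harc (a : {p : V × V // G.Adj p.1 p.2 ∧ p.1 < p.2}) :
        f (Sum.inr a) = f (Sum.inl a.1.1) := by
      by_contra h
      have h₁ := ENNReal.sum_ne_top.mp hQ a.1.1 (Finset.mem_univ _)
      have h₂ := ENNReal.sum_ne_top.mp h₁ (f (Sum.inr a))
        (Finset.mem_filter.mpr ⟨Finset.mem_univ _, h⟩)
      exact h₂ (if_pos ⟨Sum.inr a, rfl, rfl⟩)
    refine ⟨fun v => f (Sum.inl v), fun i => ?_, ?_⟩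
    · by_contra h
      exact ENNReal.sum_ne_top.mp hP (Sum.inl (t i)) (Finset.mem_univ _)
        (if_pos ⟨i, rfl, Ne.symm h⟩)
    · rw [sum_cut_eq_sum_arcs]
      simp only [harc] at hf
      exact (le_add_self.trans le_add_self).trans hf
end
end

section
/- Let G be a finite simple undirected graph with edge weights w: E(G) → [0,∞), let k ≥ 1, and let →G, G', q be as in the subdivision construction. Let f: V(G') → {1,…,k} be an assignment with Δ(f,q,G') < ∞. Then f(a(v,u)) = f(v) for every subdivision vertex a(v,u) of G'; consequently, for every i ∈ {1,…,k}, f⁻¹(i) = (f⁻¹(i) ∩ V(G)) ∪ {a(v,u) : v ∈ f⁻¹(i) ∩ V(G), (v,u) an arc of →G}. -/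
open scoped Classical
open Finset

noncomputable section

/-- A vertex with an out-neighbor on another machine contributes its full transfer weight. -/
theorem le_transferCost {V : Type*} [Fintype V] {A : V → V → Prop} {k : ℕ}
    {f : V → Fin k} (q : V → ENNReal) {v u : V} (hA : A v u) (hne : f u ≠ f v) :
    q v ≤ transferCost A k f q := by
  unfold transferCost
  calc q v = if ∃ x, A v x ∧ f x = f u then q v else 0 := (if_pos ⟨u, hA, rfl⟩).symm
    _ ≤ ∑ j ∈ Finset.univ.filter (fun j => j ≠ f v),
          if ∃ x, A v x ∧ f x = j then q v else 0 :=
      Finset.single_le_sum (f := fun j => if ∃ x, A v x ∧ f x = j then q v else 0)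
        (fun _ _ => zero_le) (by simpa using hne)
    _ ≤ ∑ y ∈ Finset.univ.filter (fun y => f y = f v),
          ∑ j ∈ Finset.univ.filter (fun j => j ≠ f v),
            if ∃ x, A y x ∧ f x = j then q y else 0 :=
      Finset.single_le_sum (f := fun y => ∑ j ∈ Finset.univ.filter (fun j => j ≠ f v),
        if ∃ x, A y x ∧ f x = j then q y else 0) (fun _ _ => zero_le) (by simp)
    _ ≤ _ :=
      Finset.single_le_sum (f := fun i => ∑ y ∈ Finset.univ.filter (fun y => f y = i),
        ∑ j ∈ Finset.univ.filter (fun j => j ≠ i),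
          if ∃ x, A y x ∧ f x = j then q y else 0) (fun _ _ => zero_le) (Finset.mem_univ _)

theorem stmt2 {V : Type*} [Fintype V] [LinearOrder V] (G : SimpleGraph V)
    (w : Sym2 V → NNReal) (k : ℕ) (hk : 1 ≤ k)
    (f : SubVertex G → Fin k)
    (hfin : transferCost (subArc G) k f (subQ G w) < ⊤) :
    (∀ a : {p : V × V // G.Adj p.1 p.2 ∧ p.1 < p.2},
        f (Sum.inr a) = f (Sum.inl a.1.1))
    ∧
    (∀ i : Fin k,
      {x : SubVertex G | f x = i}
        = (Sum.inl '' {v : V | f (Sum.inl v) = i})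
          ∪ (Sum.inr '' {a : {p : V × V // G.Adj p.1 p.2 ∧ p.1 < p.2} |
              f (Sum.inl a.1.1) = i})) := by
  have key : ∀ a : {p : V × V // G.Adj p.1 p.2 ∧ p.1 < p.2},
      f (Sum.inr a) = f (Sum.inl a.1.1) := by
    intro a
    by_contra hne
    have hA : subArc G (Sum.inl a.1.1) (Sum.inr a) := rfl
    exact ((le_transferCost (subQ G w) hA hne).trans_lt hfin).ne rfl
  refine ⟨key, fun i => ?_⟩
  ext x
  rcases x with v | a
  · simp
  · simp [key]
end
end

section
/- Let G be a finite DAG with p: V(G) × {1,2} → [0,∞) and q: V(G) → [0,∞), and let G' with arc weights w be as in the two-machine construction. Then for every r ∈ [0,∞): there exists a bipartition (V₁,V₂) of V(G) with Σ_{v∈V₁} p(v,1) + Σ_{v∈V₂} p(v,2) + Δ((V₁,V₂),q,G) ≤ r, if and only if there exists a bipartition (X,Y) of V(G') with s ∈ X, t ∈ Y, and w(Cut(X,Y,G')) ≤ r. -/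
open scoped Classical
open Finset

noncomputable section

/-- Transfer cost `Δ((V₁,V₂), q, G)` of a bipartition `(V₁, V₁ᶜ)` of the vertices of a
digraph with arc relation `A`. -/
def biTransfer {V : Type*} [Fintype V] (A : V → V → Prop)
    (V1 : Set V) (q : V → ENNReal) : ENNReal :=
  (∑ v : V, if v ∈ V1 ∧ ∃ u, A v u ∧ u ∉ V1 then q v else 0)
  + (∑ v : V, if v ∉ V1 ∧ ∃ u, A v u ∧ u ∈ V1 then q v else 0)

/-- Total weight of the cut `Cut(X, Y, H)` (arcs with tail in `X` and head in `Y`). -/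
def cutWeight {W : Type*} [Fintype W] (Arc : W → W → Prop) (w : W → W → ENNReal)
    (X Y : Set W) : ENNReal :=
  ∑ x : W, ∑ y : W, if Arc x y ∧ x ∈ X ∧ y ∈ Y then w x y else 0

/-- Vertices of the two-machine construction `G'`: the original vertices, the vertices
`v⁺` and `v⁻` for every non-sink `v`, and the two extra vertices `s = Sum.inr false`
and `t = Sum.inr true`. -/
abbrev TMV {V : Type*} (A : V → V → Prop) :=
  (V ⊕ ({v : V // ∃ u, A v u} ⊕ {v : V // ∃ u, A v u})) ⊕ Bool

/-- Arcs of `G'`: `(v,v⁺)`, `(v⁻,v)`, `(v⁺,u)` and `(u,v⁻)` for every out-neighbor `u`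
of a non-sink `v`, together with `(s,v)` and `(v,t)` for every original vertex `v`. -/
def tmArc {V : Type*} (A : V → V → Prop) : TMV A → TMV A → Prop
  | Sum.inl (Sum.inl v), Sum.inl (Sum.inr (Sum.inl a)) => a.1 = v
  | Sum.inl (Sum.inr (Sum.inr a)), Sum.inl (Sum.inl v) => a.1 = v
  | Sum.inl (Sum.inr (Sum.inl a)), Sum.inl (Sum.inl u) => A a.1 u
  | Sum.inl (Sum.inl u), Sum.inl (Sum.inr (Sum.inr a)) => A a.1 u
  | Sum.inr false, Sum.inl (Sum.inl _) => True
  | Sum.inl (Sum.inl _), Sum.inr true => True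
  | _, _ => False

/-- Arc weights of `G'`: `(v,v⁺)` and `(v⁻,v)` have weight `q(v)`; `(v⁺,u)` and
`(u,v⁻)` have weight `∞`; `(s,v)` has weight `p(v,2)` and `(v,t)` has weight `p(v,1)`. -/
def tmW {V : Type*} (A : V → V → Prop) (p1 p2 q : V → NNReal) :
    TMV A → TMV A → ENNReal
  | Sum.inl (Sum.inl v), Sum.inl (Sum.inr (Sum.inl a)) =>
      if a.1 = v then (q v : ENNReal) else 0
  | Sum.inl (Sum.inr (Sum.inr a)), Sum.inl (Sum.inl v) =>
      if a.1 = v then (q v : ENNReal) else 0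
  | Sum.inl (Sum.inr (Sum.inl a)), Sum.inl (Sum.inl u) => if A a.1 u then ⊤ else 0
  | Sum.inl (Sum.inl u), Sum.inl (Sum.inr (Sum.inr a)) => if A a.1 u then ⊤ else 0
  | Sum.inr false, Sum.inl (Sum.inl v) => (p2 v : ENNReal)
  | Sum.inl (Sum.inl v), Sum.inr true => (p1 v : ENNReal)
  | _, _ => 0

/-- The transfer cost as a sum over the non-sinks only. -/
lemma biTransfer_eq_sum_nonsink {V : Type*} [Fintype V] (A : V → V → Prop)
    (V1 : Set V) (q : V → ENNReal) :
    biTransfer A V1 q =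
      (∑ a : {v : V // ∃ u, A v u}, if a.1 ∈ V1 ∧ ∃ u, A a.1 u ∧ u ∉ V1 then q a.1 else 0)
      + (∑ a : {v : V // ∃ u, A v u},
          if a.1 ∉ V1 ∧ ∃ u, A a.1 u ∧ u ∈ V1 then q a.1 else 0) := by
  have restrict (f : V → ENNReal) (hf : ∀ v, (¬ ∃ u, A v u) → f v = 0) :
      ∑ v, f v = ∑ a : {v : V // ∃ u, A v u}, f a.1 := by
    rw [← Finset.sum_filter_of_ne fun v _ hv => by_contra fun h => hv (hf v h)]
    exact Finset.sum_subtype _ (by simp) f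
  unfold biTransfer
  congr 1
  · exact restrict _ fun v hv => if_neg fun ⟨_, u, hu, _⟩ => hv ⟨u, hu⟩
  · exact restrict _ fun v hv => if_neg fun ⟨_, u, hu, _⟩ => hv ⟨u, hu⟩

/-- The weight of an `s`-`t` cut of the two-machine construction, arc class by arc class. -/
lemma cutWeight_tm {V : Type*} [Fintype V] (A : V → V → Prop) (p1 p2 q : V → NNReal)
    (X : Set (TMV A)) (hs : Sum.inr false ∈ X) (ht : Sum.inr true ∉ X) :
    cutWeight (tmArc A) (tmW A p1 p2 q) X Xᶜ =
      (∑ v : V, if Sum.inl (Sum.inl v) ∈ X then (p1 v : ENNReal) else 0)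
      + (∑ v : V, if Sum.inl (Sum.inl v) ∉ X then (p2 v : ENNReal) else 0)
      + ((∑ a : {v : V // ∃ u, A v u},
          if Sum.inl (Sum.inl a.1) ∈ X ∧ Sum.inl (Sum.inr (Sum.inl a)) ∉ X
          then (q a.1 : ENNReal) else 0)
        + ∑ a : {v : V // ∃ u, A v u},
          if Sum.inl (Sum.inl a.1) ∉ X ∧ Sum.inl (Sum.inr (Sum.inr a)) ∈ X
          then (q a.1 : ENNReal) else 0)
      + ((∑ a : {v : V // ∃ u, A v u}, ∑ u : V,
          if A a.1 u ∧ Sum.inl (Sum.inr (Sum.inl a)) ∈ X ∧ Sum.inl (Sum.inl u) ∉ X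
          then (⊤ : ENNReal) else 0)
        + ∑ u : V, ∑ a : {v : V // ∃ u, A v u},
          if A a.1 u ∧ Sum.inl (Sum.inl u) ∈ X ∧ Sum.inl (Sum.inr (Sum.inr a)) ∉ X
          then (⊤ : ENNReal) else 0) := by
  have plus : (∑ v : V, ∑ a : {v : V // ∃ u, A v u},
      if a.1 = v ∧ Sum.inl (Sum.inl v) ∈ X ∧ Sum.inl (Sum.inr (Sum.inl a)) ∉ X
      then (if a.1 = v then (q v : ENNReal) else 0) else 0) =
      ∑ a : {v : V // ∃ u, A v u},
        if Sum.inl (Sum.inl a.1) ∈ X ∧ Sum.inl (Sum.inr (Sum.inl a)) ∉ X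
        then (q a.1 : ENNReal) else 0 := by
    rw [Finset.sum_comm]
    refine Finset.sum_congr rfl fun a _ => ?_
    rw [Finset.sum_eq_single a.1] <;> simp +contextual [eq_comm]
  have minus : (∑ a : {v : V // ∃ u, A v u}, ∑ v : V,
      if a.1 = v ∧ Sum.inl (Sum.inr (Sum.inr a)) ∈ X ∧ Sum.inl (Sum.inl v) ∉ X
      then (if a.1 = v then (q v : ENNReal) else 0) else 0) =
      ∑ a : {v : V // ∃ u, A v u},
        if Sum.inl (Sum.inl a.1) ∉ X ∧ Sum.inl (Sum.inr (Sum.inr a)) ∈ X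
        then (q a.1 : ENNReal) else 0 := by
    refine Finset.sum_congr rfl fun a _ => ?_
    rw [Finset.sum_eq_single a.1] <;> simp +contextual [eq_comm, and_comm]
  have top_ite (P Q : Prop) [Decidable P] [Decidable (P ∧ Q)] :
      (if P ∧ Q then (if P then (⊤ : ENNReal) else 0) else 0) = if P ∧ Q then ⊤ else 0 := by
    split_ifs <;> simp_all
  rw [← plus, ← minus]
  simp only [cutWeight, Fintype.sum_sum_type, Fintype.sum_bool, tmArc, tmW, Set.mem_compl_iff,
    hs, ht, top_ite, Finset.sum_add_distrib, false_and, true_and, and_true, not_true_eq_false,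
    not_false_eq_true, ite_self, Finset.sum_const_zero, add_zero, zero_add]
  ring

theorem stmt4 {V : Type*} [Fintype V] (A : V → V → Prop)
    (hdag : ∀ v, ¬ Relation.TransGen A v v)
    (p1 p2 q : V → NNReal) (r : NNReal) :
    (∃ V1 : Set V,
      (∑ v : V, if v ∈ V1 then (p1 v : ENNReal) else 0)
        + (∑ v : V, if v ∉ V1 then (p2 v : ENNReal) else 0)
        + biTransfer A V1 (fun v => (q v : ENNReal)) ≤ (r : ENNReal))
    ↔
    (∃ X : Set (TMV A),
      Sum.inr false ∈ X ∧ Sum.inr true ∉ X ∧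
      cutWeight (tmArc A) (tmW A p1 p2 q) X Xᶜ ≤ (r : ENNReal)) := by
  constructor
  · rintro ⟨V1, h⟩
    let X : Set (TMV A) := fun x => match x with
      | Sum.inl (Sum.inl v) => v ∈ V1
      | Sum.inl (Sum.inr (Sum.inl a)) => ∀ u, A a.1 u → u ∈ V1
      | Sum.inl (Sum.inr (Sum.inr a)) => ∃ u, A a.1 u ∧ u ∈ V1
      | Sum.inr b => b = false
    have mem_vertex (v : V) : Sum.inl (Sum.inl v) ∈ X ↔ v ∈ V1 := Iff.rfl
    have mem_plus (a : {v : V // ∃ u, A v u}) :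
        Sum.inl (Sum.inr (Sum.inl a)) ∈ X ↔ ∀ u, A a.1 u → u ∈ V1 := Iff.rfl
    have mem_minus (a : {v : V // ∃ u, A v u}) :
        Sum.inl (Sum.inr (Sum.inr a)) ∈ X ↔ ∃ u, A a.1 u ∧ u ∈ V1 := Iff.rfl
    have hs : Sum.inr false ∈ X := rfl
    have ht : Sum.inr true ∉ X := Bool.noConfusion
    refine ⟨X, hs, ht, le_of_eq_of_le ?_ h⟩
    have no_plus (a : {v : V // ∃ u, A v u}) (u : V) :
        ¬ (A a.1 u ∧ (∀ u, A a.1 u → u ∈ V1) ∧ u ∉ V1) := fun h => h.2.2 (h.2.1 u h.1)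
    have no_minus (a : {v : V // ∃ u, A v u}) (u : V) :
        ¬ (A a.1 u ∧ u ∈ V1 ∧ ¬ ∃ u, A a.1 u ∧ u ∈ V1) := fun h => h.2.2 ⟨u, h.1, h.2.1⟩
    rw [cutWeight_tm A p1 p2 q X hs ht, biTransfer_eq_sum_nonsink]
    simp only [mem_vertex, mem_plus, mem_minus, no_plus, no_minus, if_false,
      Finset.sum_const_zero, add_zero, not_forall, exists_prop]
  · rintro ⟨X, hs, ht, h⟩
    refine ⟨{v | Sum.inl (Sum.inl v) ∈ X}, ?_⟩
    rw [cutWeight_tm A p1 p2 q X hs ht] at h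
    have finite_arcs := ne_top_of_le_ne_top ENNReal.coe_ne_top (le_add_self.trans h)
    rw [ENNReal.add_ne_top] at finite_arcs
    have closed_plus (a : {v : V // ∃ u, A v u}) (u : V) (hu : A a.1 u)
        (ha : Sum.inl (Sum.inr (Sum.inl a)) ∈ X) : Sum.inl (Sum.inl u) ∈ X := by
      by_contra hX
      have := ENNReal.sum_ne_top.1 (ENNReal.sum_ne_top.1 finite_arcs.1 a (mem_univ a)) u
        (mem_univ u)
      exact this (if_pos ⟨hu, ha, hX⟩)
    have closed_minus (a : {v : V // ∃ u, A v u}) (u : V) (hu : A a.1 u)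
        (hX : Sum.inl (Sum.inl u) ∈ X) : Sum.inl (Sum.inr (Sum.inr a)) ∈ X := by
      by_contra ha
      have := ENNReal.sum_ne_top.1 (ENNReal.sum_ne_top.1 finite_arcs.2 u (mem_univ u)) a
        (mem_univ a)
      exact this (if_pos ⟨hu, hX, ha⟩)
    refine le_trans ?_ (le_self_add.trans h)
    rw [biTransfer_eq_sum_nonsink]
    have ite_mono {P Q : Prop} [Decidable P] [Decidable Q] (hPQ : P → Q) (c : ENNReal) :
        (if P then c else 0) ≤ if Q then c else 0 := by
      split_ifs <;> simp_all
    refine add_le_add le_rfl (add_le_add ?_ ?_)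
    · exact Finset.sum_le_sum fun a _ => ite_mono
        (fun ⟨hv, u, hu, hX⟩ => ⟨hv, fun ha => hX (closed_plus a u hu ha)⟩) _
    · exact Finset.sum_le_sum fun a _ => ite_mono
        (fun ⟨hv, u, hu, hX⟩ => ⟨hv, closed_minus a u hu hX⟩) _
end
end

section
/- Let G be a finite DAG with p: V(G) × {1,2} → [0,∞) and q: V(G) → [0,∞), and let G' with arc weights w be as in the two-machine construction. Let (X,Y) be a bipartition of V(G') with s ∈ X, t ∈ Y, and w(Cut(X,Y,G')) < ∞. Let v be a non-sink of G such that all out-neighbors of v in G lie in the same part Z ∈ {X,Y}, and set X' = Z ∪ {v⁺, v⁻} and Y' = V(G') ∖ X'. Then w(Cut(X',Y',G')) ≤ w(Cut(X,Y,G')) if s ∈ X', and w(Cut(Y',X',G')) ≤ w(Cut(X,Y,G')) if s ∈ Y'. -/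
open scoped Classical
open Finset

noncomputable section

/-- The cut weight is monotone in the set of arcs of the cut. -/
theorem cutWeight_mono {W : Type*} [Fintype W] (Arc : W → W → Prop) (w : W → W → ENNReal)
    {X Y X₁ Y₁ : Set W}
    (h : ∀ x y, Arc x y → x ∈ X₁ → y ∈ Y₁ → x ∈ X ∧ y ∈ Y) :
    cutWeight Arc w X₁ Y₁ ≤ cutWeight Arc w X Y := by
  refine Finset.sum_le_sum fun x _ => Finset.sum_le_sum fun y _ => ?_
  by_cases hxy : Arc x y ∧ x ∈ X₁ ∧ y ∈ Y₁
  · rw [if_pos hxy, if_pos ⟨hxy.1, h x y hxy.1 hxy.2.1 hxy.2.2⟩]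
  · rw [if_neg hxy]
    exact zero_le

/-- A cut of finite weight contains no arc of infinite weight. -/
theorem not_mem_cut_of_weight_eq_top {W : Type*} [Fintype W] {Arc : W → W → Prop}
    {w : W → W → ENNReal} {X Y : Set W} (hfin : cutWeight Arc w X Y < ⊤)
    {x y : W} (hxy : Arc x y) (hw : w x y = ⊤) (hx : x ∈ X) : y ∉ Y := by
  intro hy
  have h := ENNReal.sum_lt_top.1 (ENNReal.sum_lt_top.1 hfin x (mem_univ x)) y (mem_univ y)
  rw [if_pos ⟨hxy, hx, hy⟩, hw] at h
  exact lt_irrefl _ h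

/-- The only arcs leaving `v⁺` go to the out-neighbors of `v`. -/
theorem tmArc_plus_left {V : Type*} {A : V → V → Prop} {a : {v : V // ∃ u, A v u}}
    {y : TMV A} (h : tmArc A (Sum.inl (Sum.inr (Sum.inl a))) y) :
    ∃ u, A a.1 u ∧ y = Sum.inl (Sum.inl u) := by
  rcases y with (u | b | b) | b
  · exact ⟨u, h, rfl⟩
  all_goals exact h.elim

/-- The only arcs entering `v⁻` come from the out-neighbors of `v`. -/
theorem tmArc_minus_right {V : Type*} {A : V → V → Prop} {a : {v : V // ∃ u, A v u}}
    {x : TMV A} (h : tmArc A x (Sum.inl (Sum.inr (Sum.inr a)))) :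
    ∃ u, A a.1 u ∧ x = Sum.inl (Sum.inl u) := by
  rcases x with (u | b | b) | (_ | _)
  · exact ⟨u, h, rfl⟩
  all_goals exact h.elim

theorem stmt5 {V : Type*} [Fintype V] (A : V → V → Prop)
    (hdag : ∀ v, ¬ Relation.TransGen A v v)
    (p1 p2 q : V → NNReal)
    (X : Set (TMV A))
    (hs : Sum.inr false ∈ X) (ht : Sum.inr true ∉ X)
    (hfin : cutWeight (tmArc A) (tmW A p1 p2 q) X Xᶜ < ⊤)
    (v : V) (hv : ∃ u, A v u)
    (Z : Set (TMV A)) (hZ : Z = X ∨ Z = Xᶜ)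
    (hall : ∀ u, A v u → Sum.inl (Sum.inl u) ∈ Z)
    (X' : Set (TMV A))
    (hX' : X' = Z ∪ {Sum.inl (Sum.inr (Sum.inl ⟨v, hv⟩)),
                     Sum.inl (Sum.inr (Sum.inr ⟨v, hv⟩))}) :
    (Sum.inr false ∈ X' →
      cutWeight (tmArc A) (tmW A p1 p2 q) X' X'ᶜ
        ≤ cutWeight (tmArc A) (tmW A p1 p2 q) X Xᶜ)
    ∧
    (Sum.inr false ∈ X'ᶜ →
      cutWeight (tmArc A) (tmW A p1 p2 q) X'ᶜ X'
        ≤ cutWeight (tmArc A) (tmW A p1 p2 q) X Xᶜ) := by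
  obtain ⟨u, hu⟩ := id hv
  subst hX'
  rcases hZ with rfl | rfl
  · refine ⟨fun _ => cutWeight_mono _ _ fun x y hxy hx hy => ?_,
      fun h => absurd (Or.inl hs) h⟩
    have hyZ : y ∉ Z := fun h => hy (Or.inl h)
    refine ⟨?_, hyZ⟩
    rcases hx with hx | rfl | rfl
    · exact hx
    · obtain ⟨u', hu', rfl⟩ := tmArc_plus_left hxy
      exact absurd (hall u' hu') hyZ
    · exact not_not.1 (not_mem_cut_of_weight_eq_top hfin
        (show tmArc A (Sum.inl (Sum.inl u)) (Sum.inl (Sum.inr (Sum.inr ⟨v, hv⟩))) from hu)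
        (if_pos hu) (hall u hu))
  · refine ⟨fun h => ?_, fun _ => cutWeight_mono _ _ fun x y hxy hx hy => ?_⟩
    · rcases h with h | h | h
      · exact absurd hs h
      · cases h
      · cases h
    have hxX : x ∈ X := by
      by_contra h
      exact hx (Or.inl h)
    refine ⟨hxX, ?_⟩
    rcases hy with hy | rfl | rfl
    · exact hy
    · intro hplus
      exact not_mem_cut_of_weight_eq_top hfin
        (show tmArc A (Sum.inl (Sum.inr (Sum.inl ⟨v, hv⟩))) (Sum.inl (Sum.inl u)) from hu)
        (if_pos hu) hplus (hall u hu)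
    · obtain ⟨u', hu', rfl⟩ := tmArc_minus_right hxy
      exact absurd hxX (hall u' hu')
end
end

section
/- Let G be a finite DAG with p: V(G) × {1,2} → [0,∞) and q: V(G) → [0,∞), and let G' with arc weights w be as in the two-machine construction. Let (X,Y) be a bipartition of V(G') with s ∈ X, t ∈ Y, and w(Cut(X,Y,G')) < ∞. Let v ∈ X ∩ V(G) have at least one out-neighbor in G that lies in Y. Then the arc (v, v⁺) belongs to Cut(X,Y,G') (in particular v⁺ ∈ Y), and no arc of G' entering or leaving v⁻ belongs to Cut(X,Y,G'). -/
open scoped Classical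
open Finset

noncomputable section

/-- Every arc of a cut of finite total weight has finite weight. -/
theorem weight_ne_top_of_cutWeight_lt_top {W : Type*} [Fintype W] {Arc : W → W → Prop}
    {w : W → W → ENNReal} {X Y : Set W} (h : cutWeight Arc w X Y < ⊤) {x y : W}
    (hxy : Arc x y) (hx : x ∈ X) (hy : y ∈ Y) : w x y ≠ ⊤ := by
  have h₁ := ENNReal.sum_lt_top.1 h x (mem_univ x)
  have h₂ := ENNReal.sum_lt_top.1 h₁ y (mem_univ y)
  rw [if_pos ⟨hxy, hx, hy⟩] at h₂
  exact h₂.ne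

theorem stmt6 {V : Type*} [Fintype V] (A : V → V → Prop)
    (hdag : ∀ v, ¬ Relation.TransGen A v v)
    (p1 p2 q : V → NNReal)
    (X : Set (TMV A))
    (hs : Sum.inr false ∈ X) (ht : Sum.inr true ∉ X)
    (hfin : cutWeight (tmArc A) (tmW A p1 p2 q) X Xᶜ < ⊤)
    (v : V) (hvX : Sum.inl (Sum.inl v) ∈ X)
    (u : V) (hu : A v u) (huY : Sum.inl (Sum.inl u) ∈ Xᶜ) :
    -- the arc (v, v⁺) belongs to Cut(X, Y, G')
    (tmArc A (Sum.inl (Sum.inl v)) (Sum.inl (Sum.inr (Sum.inl ⟨v, u, hu⟩)))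
      ∧ Sum.inl (Sum.inl v) ∈ X
      ∧ Sum.inl (Sum.inr (Sum.inl (⟨v, u, hu⟩ : {x : V // ∃ y, A x y}))) ∈ Xᶜ)
    ∧
    -- no arc of G' entering or leaving v⁻ belongs to Cut(X, Y, G')
    (∀ x y : TMV A, tmArc A x y →
      (x = Sum.inl (Sum.inr (Sum.inr (⟨v, u, hu⟩ : {x : V // ∃ y, A x y})))
        ∨ y = Sum.inl (Sum.inr (Sum.inr (⟨v, u, hu⟩ : {x : V // ∃ y, A x y})))) →
      ¬(x ∈ X ∧ y ∈ Xᶜ)) := by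
  refine ⟨⟨rfl, hvX, fun hX => ?_⟩, ?_⟩
  · exact weight_ne_top_of_cutWeight_lt_top hfin (x := Sum.inl (Sum.inr (Sum.inl ⟨v, u, hu⟩)))
      (y := Sum.inl (Sum.inl u)) hu hX huY (if_pos hu)
  · rintro x y hxy (rfl | rfl) ⟨hx, hy⟩
    · rcases y with (z | z | z) | _ | _
      · obtain rfl : v = z := hxy
        exact hy hvX
      all_goals exact hxy
    · rcases x with (z | z | z) | _ | _
      · exact weight_ne_top_of_cutWeight_lt_top hfin hxy hx hy (if_pos hxy)
      all_goals exact hxy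
end
end

section
/- Let G be a finite DAG with p: V(G) × {1,2} → [0,∞) and q: V(G) → [0,∞), and let G' with arc weights w be as in the two-machine construction. Let (X,Y) be a bipartition of V(G') with s ∈ X, t ∈ Y, and w(Cut(X,Y,G')) < ∞. Let v ∈ Y ∩ V(G) have at least one out-neighbor in G that lies in X. Then the arc (v⁻, v) belongs to Cut(X,Y,G') (in particular v⁻ ∈ X), and no arc of G' entering or leaving v⁺ belongs to Cut(X,Y,G'). -/
open scoped Classical
open Finset

noncomputable section

/-- A cut of finite total weight contains no arc of infinite weight. -/
theorem ne_top_of_cutWeight_lt_top {W : Type*} [Fintype W] {Arc : W → W → Prop}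
    {w : W → W → ENNReal} {X Y : Set W} (hfin : cutWeight Arc w X Y < ⊤) {x y : W}
    (hxy : Arc x y) (hx : x ∈ X) (hy : y ∈ Y) : w x y ≠ ⊤ := by
  have h := ENNReal.sum_lt_top.1 (ENNReal.sum_lt_top.1 hfin x (mem_univ x)) y (mem_univ y)
  rw [if_pos ⟨hxy, hx, hy⟩] at h
  exact h.ne

theorem stmt7 {V : Type*} [Fintype V] (A : V → V → Prop)
    (hdag : ∀ v, ¬ Relation.TransGen A v v)
    (p1 p2 q : V → NNReal)
    (X : Set (TMV A))
    (hs : Sum.inr false ∈ X) (ht : Sum.inr true ∉ X)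
    (hfin : cutWeight (tmArc A) (tmW A p1 p2 q) X Xᶜ < ⊤)
    (v : V) (hvY : Sum.inl (Sum.inl v) ∈ Xᶜ)
    (u : V) (hu : A v u) (huX : Sum.inl (Sum.inl u) ∈ X) :
    -- the arc (v⁻, v) belongs to Cut(X, Y, G')
    (tmArc A (Sum.inl (Sum.inr (Sum.inr (⟨v, u, hu⟩ : {x : V // ∃ y, A x y}))))
      (Sum.inl (Sum.inl v))
      ∧ Sum.inl (Sum.inr (Sum.inr (⟨v, u, hu⟩ : {x : V // ∃ y, A x y}))) ∈ X
      ∧ Sum.inl (Sum.inl v) ∈ Xᶜ)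
    ∧
    -- no arc of G' entering or leaving v⁺ belongs to Cut(X, Y, G')
    (∀ x y : TMV A, tmArc A x y →
      (x = Sum.inl (Sum.inr (Sum.inl (⟨v, u, hu⟩ : {x : V // ∃ y, A x y})))
        ∨ y = Sum.inl (Sum.inr (Sum.inl (⟨v, u, hu⟩ : {x : V // ∃ y, A x y})))) →
      ¬(x ∈ X ∧ y ∈ Xᶜ)) := by
  refine ⟨⟨rfl, ?_, hvY⟩, ?_⟩
  · by_contra hX
    exact ne_top_of_cutWeight_lt_top hfin (x := Sum.inl (Sum.inl u))
      (y := Sum.inl (Sum.inr (Sum.inr ⟨v, u, hu⟩))) hu huX hX (if_pos hu)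
  · rintro x y hxy (rfl | rfl) ⟨hx, hy⟩
    · rcases y with (y | y | y) | y
      · exact ne_top_of_cutWeight_lt_top hfin hxy hx hy (if_pos hxy)
      all_goals exact hxy
    · rcases x with (x | x | x) | (_ | _)
      · obtain rfl : v = x := hxy
        exact hvY hx
      all_goals exact hxy
end
end

section
/- Let G be a finite DAG with p: V(G) × {1,2} → [0,∞) and q: V(G) → [0,∞), and let G' with arc weights w be as in the two-machine construction. Let (V₁,V₂) be a bipartition of V(G). Define X = {s} ∪ V₁ ∪ {v⁺, v⁻ : v a non-sink of G with v ∈ V₁ and all out-neighbors of v in G contained in V₁} ∪ {v⁻ : v ∈ V₁ with at least one out-neighbor in V₂} ∪ {v⁻ : v ∈ V₂ with at least one out-neighbor in V₁}, and Y = V(G') ∖ X. Then s ∈ X, t ∈ Y, and w(Cut(X,Y,G')) = Σ_{v∈V₁} p(v,1) + Σ_{v∈V₂} p(v,2) + Δ((V₁,V₂),q,G). -/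
open scoped Classical
open Finset

noncomputable section

/-- A sum over a subtype is the sum over the whole type of the terms restricted by an indicator. -/
theorem sum_subtype_eq_sum_ite {V : Type*} [Fintype V] (P : V → Prop)
    [Fintype {v : V // P v}] (f : V → ENNReal) :
    ∑ a : {v : V // P v}, f a.1 = ∑ v : V, if P v then f v else 0 := by
  rw [← Finset.sum_filter]
  exact (Finset.sum_subtype _ (by simp) f).symm

theorem stmt8 {V : Type*} [Fintype V] (A : V → V → Prop)
    (hdag : ∀ v, ¬ Relation.TransGen A v v)
    (p1 p2 q : V → NNReal)
    (V1 : Set V)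
    (X : Set (TMV A))
    (hX : X = fun x : TMV A => match x with
      | Sum.inr b => b = false
      | Sum.inl (Sum.inl v) => v ∈ V1
      | Sum.inl (Sum.inr (Sum.inl a)) => a.1 ∈ V1 ∧ ∀ u, A a.1 u → u ∈ V1
      | Sum.inl (Sum.inr (Sum.inr a)) =>
          (a.1 ∈ V1 ∧ ∀ u, A a.1 u → u ∈ V1)
          ∨ (a.1 ∈ V1 ∧ ∃ u, A a.1 u ∧ u ∉ V1)
          ∨ (a.1 ∉ V1 ∧ ∃ u, A a.1 u ∧ u ∈ V1)) :
    Sum.inr false ∈ X ∧ Sum.inr true ∈ Xᶜ ∧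
    cutWeight (tmArc A) (tmW A p1 p2 q) X Xᶜ
      = (∑ v : V, if v ∈ V1 then (p1 v : ENNReal) else 0)
        + (∑ v : V, if v ∉ V1 then (p2 v : ENNReal) else 0)
        + biTransfer A V1 (fun v => (q v : ENNReal)) := by
  have mem_source : (Sum.inr false : TMV A) ∈ X := by rw [hX]; rfl
  have mem_sink : (Sum.inr true : TMV A) ∉ X := by rw [hX]; exact Bool.noConfusion
  have mem_vertex (v : V) : (Sum.inl (Sum.inl v) : TMV A) ∈ X ↔ v ∈ V1 := by rw [hX]; rfl
  have mem_plus (a : {v : V // ∃ u, A v u}) :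
      (Sum.inl (Sum.inr (Sum.inl a)) : TMV A) ∈ X ↔ a.1 ∈ V1 ∧ ∀ u, A a.1 u → u ∈ V1 := by
    rw [hX]; rfl
  have mem_minus (a : {v : V // ∃ u, A v u}) :
      (Sum.inl (Sum.inr (Sum.inr a)) : TMV A) ∈ X ↔
        a.1 ∈ V1 ∨ ∃ u, A a.1 u ∧ u ∈ V1 := by
    have h : (Sum.inl (Sum.inr (Sum.inr a)) : TMV A) ∈ X ↔
        (a.1 ∈ V1 ∧ ∀ u, A a.1 u → u ∈ V1) ∨ (a.1 ∈ V1 ∧ ∃ u, A a.1 u ∧ u ∉ V1)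
          ∨ (a.1 ∉ V1 ∧ ∃ u, A a.1 u ∧ u ∈ V1) := by rw [hX]; rfl
    rw [h]
    grind
  have plus_arc (a : {v : V // ∃ u, A v u}) (u : V) :
      ¬ (A a.1 u ∧ (a.1 ∈ V1 ∧ ∀ u, A a.1 u → u ∈ V1) ∧ u ∉ V1) := by grind
  have minus_arc (u : V) (a : {v : V // ∃ u, A v u}) :
      ¬ (A a.1 u ∧ u ∈ V1 ∧ ¬ (a.1 ∈ V1 ∨ ∃ u, A a.1 u ∧ u ∈ V1)) := by grind
  have sum_plus :
      ∑ v : V, ∑ a : {v : V // ∃ u, A v u},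
        (if a.1 = v ∧ v ∈ V1 ∧ ¬ (a.1 ∈ V1 ∧ ∀ u, A a.1 u → u ∈ V1) then
          if a.1 = v then (q v : ENNReal) else 0 else 0)
      = ∑ v : V, if v ∈ V1 ∧ ∃ u, A v u ∧ u ∉ V1 then (q v : ENNReal) else 0 := by
    refine Finset.sum_congr rfl fun v _ => ?_
    rw [sum_subtype_eq_sum_ite (fun v => ∃ u, A v u) (fun x =>
      if x = v ∧ v ∈ V1 ∧ ¬ (x ∈ V1 ∧ ∀ u, A x u → u ∈ V1) then
          if x = v then (q v : ENNReal) else 0 else 0), Fintype.sum_eq_single v]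
    · split_ifs <;> grind
    · intro x hx
      simp [hx]
  have sum_minus :
      ∑ a : {v : V // ∃ u, A v u}, ∑ v : V,
        (if a.1 = v ∧ (a.1 ∈ V1 ∨ ∃ u, A a.1 u ∧ u ∈ V1) ∧ v ∉ V1 then
          if a.1 = v then (q v : ENNReal) else 0 else 0)
      = ∑ v : V, if v ∉ V1 ∧ ∃ u, A v u ∧ u ∈ V1 then (q v : ENNReal) else 0 := by
    rw [sum_subtype_eq_sum_ite (fun v => ∃ u, A v u) (fun x => ∑ v : V,
      if x = v ∧ (x ∈ V1 ∨ ∃ u, A x u ∧ u ∈ V1) ∧ v ∉ V1 then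
          if x = v then (q v : ENNReal) else 0 else 0)]
    refine Finset.sum_congr rfl fun x _ => ?_
    rw [Fintype.sum_eq_single x]
    · split_ifs <;> grind
    · intro v hv
      simp [hv.symm]
  refine ⟨mem_source, mem_sink, ?_⟩
  simp only [cutWeight, biTransfer, Fintype.sum_sum_type, Fintype.sum_bool, tmArc, tmW,
    Set.mem_compl_iff, mem_source, mem_sink, mem_vertex, mem_plus, mem_minus, plus_arc, minus_arc,
    Finset.sum_add_distrib, sum_plus, sum_minus, if_false, false_and, true_and, not_false_eq_true,
    and_true, Finset.sum_const_zero, add_zero, zero_add]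
  ring
end
end

section
/- Let G be a finite DAG with p: V(G) × {1,2} → [0,∞) and q: V(G) → [0,∞), and let G' with arc weights w be as in the two-machine construction. Let (X,Y) be a bipartition of V(G') with s ∈ X, t ∈ Y, and w(Cut(X,Y,G')) < ∞, and suppose: (i) for every non-sink v of G such that v and all out-neighbors of v in G lie in the same part Z ∈ {X,Y}, both v⁺ and v⁻ lie in Z; and (ii) for every v ∈ V(G) that has at least one out-neighbor in G lying in the part of (X,Y) opposite to the part containing v, it holds that v⁺ ∈ Y and v⁻ ∈ X. Then, setting V₁ = X ∩ V(G) and V₂ = Y ∩ V(G), we have w(Cut(X,Y,G')) = Σ_{v∈V₁} p(v,1) + Σ_{v∈V₂} p(v,2) + Δ((V₁,V₂),q,G). -/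
open scoped Classical
open Finset

noncomputable section

/-- A sum over the non-sinks that is supported at `v` collapses to the term at `v`. -/
theorem sum_nonsink_eq {V : Type*} [Fintype V] {A : V → V → Prop}
    (v : V) (f : {x : V // ∃ u, A x u} → ENNReal) (c : ENNReal)
    (hne : ∀ a, a.1 ≠ v → f a = 0) (hv : ∀ h : ∃ u, A v u, f ⟨v, h⟩ = c)
    (hc : (¬ ∃ u, A v u) → c = 0) : ∑ a, f a = c := by
  by_cases h : ∃ u, A v u
  · rw [Fintype.sum_eq_single (⟨v, h⟩ : {x : V // ∃ u, A x u}), hv h]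
    exact fun a ha => hne a fun e => ha (Subtype.ext e)
  · rw [hc h]
    exact Finset.sum_eq_zero fun a _ => hne a fun e => h (e ▸ a.2)

theorem stmt9 {V : Type*} [Fintype V] (A : V → V → Prop)
    (hdag : ∀ v, ¬ Relation.TransGen A v v)
    (p1 p2 q : V → NNReal)
    (X : Set (TMV A))
    (hs : Sum.inr false ∈ X) (ht : Sum.inr true ∉ X)
    (hfin : cutWeight (tmArc A) (tmW A p1 p2 q) X Xᶜ < ⊤)
    -- (i): if a non-sink v and all its out-neighbors lie in the same part,
    -- then v⁺ and v⁻ lie in that part as well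
    (hi : ∀ (v : V) (hv : ∃ u, A v u),
      (Sum.inl (Sum.inl v) ∈ X ∧ (∀ u, A v u → Sum.inl (Sum.inl u) ∈ X) →
        Sum.inl (Sum.inr (Sum.inl (⟨v, hv⟩ : {x : V // ∃ y, A x y}))) ∈ X
          ∧ Sum.inl (Sum.inr (Sum.inr (⟨v, hv⟩ : {x : V // ∃ y, A x y}))) ∈ X)
      ∧
      (Sum.inl (Sum.inl v) ∈ Xᶜ ∧ (∀ u, A v u → Sum.inl (Sum.inl u) ∈ Xᶜ) →
        Sum.inl (Sum.inr (Sum.inl (⟨v, hv⟩ : {x : V // ∃ y, A x y}))) ∈ Xᶜ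
          ∧ Sum.inl (Sum.inr (Sum.inr (⟨v, hv⟩ : {x : V // ∃ y, A x y}))) ∈ Xᶜ))
    -- (ii): if v has an out-neighbor in the opposite part, then v⁺ ∈ Y and v⁻ ∈ X
    (hii : ∀ (v : V) (hv : ∃ u, A v u),
      (∃ u, A v u ∧ (Sum.inl (Sum.inl v) ∈ X ↔ Sum.inl (Sum.inl u) ∈ Xᶜ)) →
        Sum.inl (Sum.inr (Sum.inl (⟨v, hv⟩ : {x : V // ∃ y, A x y}))) ∈ Xᶜ
          ∧ Sum.inl (Sum.inr (Sum.inr (⟨v, hv⟩ : {x : V // ∃ y, A x y}))) ∈ X) :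
    cutWeight (tmArc A) (tmW A p1 p2 q) X Xᶜ
      = (∑ v : V, if Sum.inl (Sum.inl v) ∈ X then (p1 v : ENNReal) else 0)
        + (∑ v : V, if Sum.inl (Sum.inl v) ∉ X then (p2 v : ENNReal) else 0)
        + biTransfer A {v : V | Sum.inl (Sum.inl v) ∈ X} (fun v => (q v : ENNReal)) := by
  have hplus : ∀ v, (∑ a : {x : V // ∃ u, A x u},
      if a.1 = v ∧ Sum.inl (Sum.inl v) ∈ X ∧ Sum.inl (Sum.inr (Sum.inl a)) ∉ X then
        (if a.1 = v then (q v : ENNReal) else 0) else 0)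
      = if Sum.inl (Sum.inl v) ∈ X ∧ ∃ u, A v u ∧ Sum.inl (Sum.inl u) ∉ X then
        (q v : ENNReal) else 0 := by
    intro v
    refine sum_nonsink_eq v _ _ (fun a ha => by simp [ha]) (fun h => ?_) (fun h => ?_)
    · have h1 := hi v h
      have h2 := hii v h
      simp only [Set.mem_compl_iff] at h1 h2
      simp only [true_and, if_true]
      congr 1
      grind
    · grind
  have hminus : ∀ v, (∑ a : {x : V // ∃ u, A x u},
      if a.1 = v ∧ Sum.inl (Sum.inr (Sum.inr a)) ∈ X ∧ Sum.inl (Sum.inl v) ∉ X then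
        (if a.1 = v then (q v : ENNReal) else 0) else 0)
      = if Sum.inl (Sum.inl v) ∉ X ∧ ∃ u, A v u ∧ Sum.inl (Sum.inl u) ∈ X then
        (q v : ENNReal) else 0 := by
    intro v
    refine sum_nonsink_eq v _ _ (fun a ha => by simp [ha]) (fun h => ?_) (fun h => ?_)
    · have h1 := hi v h
      have h2 := hii v h
      simp only [Set.mem_compl_iff] at h1 h2
      simp only [true_and, if_true]
      congr 1
      grind
    · grind
  have hplus_top : ∀ (a : {x : V // ∃ u, A x u}) (u : V),
      ¬ (A a.1 u ∧ Sum.inl (Sum.inr (Sum.inl a)) ∈ X ∧ Sum.inl (Sum.inl u) ∉ X) := by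
    rintro ⟨v, h⟩ u
    have h1 := hi v h
    have h2 := hii v h
    simp only [Set.mem_compl_iff] at h1 h2
    grind
  have hminus_top : ∀ (a : {x : V // ∃ u, A x u}) (u : V),
      ¬ (A a.1 u ∧ Sum.inl (Sum.inl u) ∈ X ∧ Sum.inl (Sum.inr (Sum.inr a)) ∉ X) := by
    rintro ⟨v, h⟩ u
    have h1 := hi v h
    have h2 := hii v h
    simp only [Set.mem_compl_iff] at h1 h2
    grind
  simp only [cutWeight, biTransfer, Fintype.sum_sum_type, Fintype.sum_bool, tmArc, tmW,
    Set.mem_compl_iff, Set.mem_ofPred_eq, hplus_top, hminus_top, hs, ht, hplus,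
    Finset.sum_add_distrib, false_and, true_and, and_true, not_false_eq_true, if_false,
    Finset.sum_const_zero, add_zero, zero_add]
  rw [Finset.sum_comm (s := (Finset.univ : Finset {x : V // ∃ u, A x u}))]
  simp only [hminus]
  ring
end
end

section
/- Let G be the directed path with vertices v₁, v₂, …, vₙ and arcs (v_i, v_{i+1}) for 1 ≤ i ≤ n−1, let k ≥ 1, and let p: V(G) × {1,…,k} → [0,∞) and q: V(G) → [0,∞). Then the minimum over all assignments f: V(G) → {1,…,k} of Σ_{v∈V(G)} p(v, f(v)) + Δ(f,q,G) equals min_{j ∈ {1,…,k}} S(n,j). -/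
open scoped Classical
open Finset

noncomputable section

/-- The directed path on `m + 1` vertices `v₁, …, v_{m+1}` (indexed by `Fin (m+1)`)
with arcs `(v_i, v_{i+1})`. -/
def pathArc (m : ℕ) : Fin (m + 1) → Fin (m + 1) → Prop :=
  fun a b => (a : ℕ) + 1 = (b : ℕ)

/-- The dynamic-programming table: `S i j` is `p(v_i, j)` plus the minimum, over all
assignments `f` of the first `i` vertices (equivalently, of all vertices) with
`f(v_i) = j`, of the execution cost of the vertices before `v_i` plus the transfer
cost of the arcs before `v_i`. -/
def S {m k : ℕ} (p : Fin (m + 1) → Fin k → NNReal) (q : Fin (m + 1) → NNReal)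
    (i : Fin (m + 1)) (j : Fin k) : ENNReal :=
  (p i j : ENNReal) +
    ⨅ (f : Fin (m + 1) → Fin k) (_ : f i = j),
      (∑ x : Fin (m + 1), if (x : ℕ) < (i : ℕ) then (p x (f x) : ENNReal) else 0)
      + (∑ a : Fin m,
          if (a : ℕ) < (i : ℕ) ∧ f a.castSucc ≠ f a.succ
          then (q a.castSucc : ENNReal) else 0)

/-- Along the directed path, the transfer cost charges exactly the arcs whose endpoints
lie on different machines. -/
lemma transferCost_pathArc {m k : ℕ} (f : Fin (m + 1) → Fin k) (q : Fin (m + 1) → ENNReal) :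
    transferCost (pathArc m) k f q =
      ∑ a : Fin m, if f a.castSucc ≠ f a.succ then q a.castSucc else 0 := by
  have fiberwise : transferCost (pathArc m) k f q =
      ∑ v, ∑ j ∈ univ.filter (fun j => j ≠ f v),
        if ∃ u, pathArc m v u ∧ f u = j then q v else 0 := by
    unfold transferCost
    rw [← Finset.sum_fiberwise univ f]
    refine Finset.sum_congr rfl fun i _ => Finset.sum_congr rfl fun v hv => ?_
    obtain rfl := (Finset.mem_filter.mp hv).2
    congr!
  have arc_castSucc (a : Fin m) (j : Fin k) :
      (∃ u, pathArc m a.castSucc u ∧ f u = j) ↔ f a.succ = j := by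
    constructor
    · rintro ⟨u, hu, rfl⟩
      have : a.succ = u := Fin.ext (by simpa [pathArc] using hu)
      rw [this]
    · exact fun h => ⟨a.succ, by simp [pathArc], h⟩
  have arc_last (j : Fin k) : ¬ ∃ u, pathArc m (Fin.last m) u ∧ f u = j := by
    rintro ⟨u, hu, -⟩
    have := u.isLt
    simp only [pathArc, Fin.val_last] at hu
    omega
  rw [fiberwise, Fin.sum_univ_castSucc]
  simp only [arc_castSucc, arc_last, if_false, Finset.sum_const_zero, add_zero]
  refine Finset.sum_congr rfl fun a _ => ?_
  rw [Finset.sum_ite_eq]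
  simp [eq_comm]

/-- The table entry at the last vertex is the minimum total cost over the assignments
that send the last vertex to `j`. -/
lemma S_last {m k : ℕ} (p : Fin (m + 1) → Fin k → NNReal) (q : Fin (m + 1) → NNReal)
    (j : Fin k) :
    S p q (Fin.last m) j = ⨅ (f : Fin (m + 1) → Fin k) (_ : f (Fin.last m) = j),
      (∑ v, (p v (f v) : ENNReal))
        + transferCost (pathArc m) k f (fun v => (q v : ENNReal)) := by
  have : Nonempty {f : Fin (m + 1) → Fin k // f (Fin.last m) = j} := ⟨⟨fun _ => j, rfl⟩⟩
  unfold S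
  rw [iInf_subtype', iInf_subtype', ENNReal.add_iInf]
  refine iInf_congr fun ⟨f, hf⟩ => ?_
  subst hf
  simp only [transferCost_pathArc, Fin.sum_univ_castSucc, Fin.val_castSucc, Fin.val_last,
    Fin.is_lt, lt_irrefl, if_true, if_false, true_and, add_zero]
  ring

theorem stmt12 {m k : ℕ} (hk : 1 ≤ k)
    (p : Fin (m + 1) → Fin k → NNReal) (q : Fin (m + 1) → NNReal) :
    (⨅ f : Fin (m + 1) → Fin k,
      (∑ v : Fin (m + 1), (p v (f v) : ENNReal))
        + transferCost (pathArc m) k f (fun v => (q v : ENNReal)))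
    = ⨅ j : Fin k, S p q (Fin.last m) j := by
  simp only [S_last]
  rw [iInf_comm]
  simp only [iInf_iInf_eq_right]
end
end

section
/- Let ℓ ≥ 1, let G be a d-regular finite simple undirected graph on n vertices with d > ℓ, and let G' with edge weights w be as in the clique-reduction construction. If K ⊆ V(G) is a clique of G with |K| = ℓ, then the cut weight of the bipartition (K ∪ {s}, (V(G) ∖ K) ∪ {t}) of V(G') equals n·(d+2) − ℓ². -/
open scoped Classical
open Finset

noncomputable section

/-- Adjacency of the graph `G'` of the clique-reduction construction: `G` together with
two new non-adjacent vertices `s = Sum.inr false` and `t = Sum.inr true`, each adjacent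
to all vertices of `G`. -/
def cliqueRedAdj {V : Type*} (G : SimpleGraph V) : (V ⊕ Bool) → (V ⊕ Bool) → Prop
  | Sum.inl a, Sum.inl b => G.Adj a b
  | Sum.inl _, Sum.inr _ => True
  | Sum.inr _, Sum.inl _ => True
  | Sum.inr _, Sum.inr _ => False

/-- Edge weights of `G'`: `d + 2` on edges incident to `s = Sum.inr false`, and `1` on
all other edges. -/
def cliqueRedW {V : Type*} (d : ℕ) (x y : V ⊕ Bool) : ℕ :=
  if x = Sum.inr false ∨ y = Sum.inr false then d + 2 else 1

/-- The cut weight of the bipartition `(Vs, Vsᶜ)` of `V(G')`: the sum of the weights of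
the edges of `G'` with one endpoint in `Vs` and the other in `Vsᶜ` (each such edge is
counted exactly once, from its endpoint in `Vs`). -/
def cliqueRedCutWeight {V : Type*} [Fintype V] [DecidableEq V] (G : SimpleGraph V)
    (d : ℕ) (Vs : Finset (V ⊕ Bool)) : ℕ :=
  ∑ x ∈ Vs, ∑ y ∈ Vsᶜ, if cliqueRedAdj G x y then cliqueRedW d x y else 0

theorem SimpleGraph.IsClique.card_neighborFinset_sdiff {V : Type*} [Fintype V] [DecidableEq V]
    {G : SimpleGraph V} [DecidableRel G.Adj] {K : Finset V} (hK : G.IsClique (K : Set V))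
    {v : V} (hv : v ∈ K) : #{w ∈ Kᶜ | G.Adj v w} + #K = G.degree v + 1 := by
  have hin : {w ∈ K | G.Adj v w} = K.erase v := by
    ext w
    simp only [mem_filter, mem_erase]
    exact ⟨fun h => ⟨h.2.ne', h.1⟩, fun h => ⟨h.2, hK hv h.2 h.1.symm⟩⟩
  have hdeg : #{w ∈ K | G.Adj v w} + #{w ∈ Kᶜ | G.Adj v w} = G.degree v := by
    rw [← G.card_neighborFinset_eq_degree, G.neighborFinset_eq_filter,
      ← card_union_of_disjoint (disjoint_filter_filter disjoint_compl_right), ← filter_union,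
      union_compl]
  have := card_erase_add_one hv
  rw [hin] at hdeg
  omega

theorem compl_image_inl_union_singleton {V : Type*} [Fintype V] [DecidableEq V] (K : Finset V) :
    (K.image Sum.inl ∪ {Sum.inr false} : Finset (V ⊕ Bool))ᶜ
      = Kᶜ.image Sum.inl ∪ {Sum.inr true} := by
  ext (v | b)
  · simp
  · cases b <;> simp

theorem sum_image_inl_union_singleton {V : Type*} [DecidableEq V] (K : Finset V) (b : Bool)
    (f : V ⊕ Bool → ℕ) :
    ∑ x ∈ K.image Sum.inl ∪ {Sum.inr b}, f x = ∑ v ∈ K, f (Sum.inl v) + f (Sum.inr b) := by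
  rw [sum_union (by simp), sum_image (by simp), sum_singleton]

theorem stmt13 {V : Type*} [Fintype V] [DecidableEq V] (G : SimpleGraph V)
    [DecidableRel G.Adj] (d ℓ : ℕ) (hℓ : 1 ≤ ℓ) (hd : ℓ < d)
    (hreg : ∀ v : V, G.degree v = d)
    (K : Finset V) (hclique : G.IsClique (K : Set V)) (hcard : K.card = ℓ) :
    (cliqueRedCutWeight G d (K.image Sum.inl ∪ {Sum.inr false}) : ℤ)
      = (Fintype.card V : ℤ) * (d + 2) - ℓ ^ 2 := by
  have hout : ∀ v ∈ K, (#{w ∈ Kᶜ | G.Adj v w} : ℤ) = d + 1 - ℓ := fun v hv => by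
    have := hclique.card_neighborFinset_sdiff hv
    rw [hreg, hcard] at this
    omega
  have hcompl : (#Kᶜ : ℤ) = Fintype.card V - ℓ := by
    have := card_add_card_compl K
    omega
  have hcut : cliqueRedCutWeight G d (K.image Sum.inl ∪ {Sum.inr false})
      = ∑ v ∈ K, (#{w ∈ Kᶜ | G.Adj v w} + 1) + #Kᶜ * (d + 2) := by
    unfold cliqueRedCutWeight
    have hc := compl_image_inl_union_singleton K
    have hs := sum_image_inl_union_singleton (V := V)
    convert_to ∑ x ∈ K.image Sum.inl ∪ {Sum.inr false}, ∑ y ∈ Kᶜ.image Sum.inl ∪ {Sum.inr true},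
      (if cliqueRedAdj G x y then cliqueRedW d x y else 0) = _
    · rw [← hc]
    simp only [hs]
    simp [cliqueRedAdj, cliqueRedW, sum_add_distrib]
  rw [hcut]
  push_cast
  rw [sum_congr rfl fun v hv => by rw [hout v hv], sum_const, hcard, hcompl]
  simp only [nsmul_eq_mul]
  ring
end
end

section
/- Let G be a d-regular finite simple undirected graph and let K ⊆ V(G) with |K| = ℓ. If the number of edges of G with exactly one endpoint in K is at most ℓ·(d − ℓ + 1), then K is a clique of G. -/
/-- The neighbours of `v` outside `K` and the non-neighbours of `v` inside `K` are related by
the degree of `v`. -/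
theorem degree_add_card_filter_not_adj {V : Type*} [Fintype V] [DecidableEq V]
    (G : SimpleGraph V) [DecidableRel G.Adj] (K : Finset V) (v : V) :
    G.degree v + (K.filter fun u => ¬ G.Adj v u).card
      = (∑ u ∈ Kᶜ, if G.Adj v u then 1 else 0) + K.card := by
  have h₁ : G.degree v = ∑ u, if G.Adj v u then 1 else 0 := by
    rw [← SimpleGraph.card_neighborFinset_eq_degree, SimpleGraph.neighborFinset_eq_filter,
      Finset.card_filter]
  have h₂ := Finset.card_filter_add_card_filter_not (s := K) (fun u => G.Adj v u)
  rw [Finset.card_filter (fun u => G.Adj v u)] at h₂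
  rw [h₁, ← Finset.sum_add_sum_compl K]
  omega

theorem stmt14 {V : Type*} [Fintype V] [DecidableEq V] (G : SimpleGraph V)
    [DecidableRel G.Adj] (d ℓ : ℕ)
    (hreg : ∀ v : V, G.degree v = d)
    (K : Finset V) (hcard : K.card = ℓ)
    (hcross : ((∑ v ∈ K, ∑ u ∈ Kᶜ, if G.Adj v u then 1 else 0 : ℕ) : ℤ)
      ≤ (ℓ : ℤ) * ((d : ℤ) - ℓ + 1)) :
    G.IsClique (K : Set V) := by
  intro a ha b hb hab
  by_contra hadj
  have key (v : V) := degree_add_card_filter_not_adj G K v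
  simp only [hreg, hcard] at key
  refine hcross.not_gt ?_
  rw [Nat.cast_sum, ← hcard, ← nsmul_eq_mul, ← Finset.sum_const, hcard]
  refine Finset.sum_lt_sum (fun v hv => ?_) ⟨a, ha, ?_⟩
  · have hpos : 0 < (K.filter fun u => ¬ G.Adj v u).card :=
      Finset.card_pos.2 ⟨v, by simp [hv]⟩
    have := key v
    omega
  · have htwo : 1 < (K.filter fun u => ¬ G.Adj a u).card :=
      Finset.one_lt_card.2 ⟨a, by simpa using ha, b, by simpa [hadj] using hb, hab⟩
    have := key a
    omega
end

section
/- Let ℓ ≥ 1, let G be a d-regular finite simple undirected graph on n vertices with d > ℓ, and let G' with edge weights w be as in the clique-reduction construction. Let (V_s,V_t) be a bipartition of V(G') with s ∈ V_s and t ∈ V_t, and let v ∈ V_t ∖ {t}. Then the cut weight of the bipartition (V_s ∪ {v}, V_t ∖ {v}) is strictly smaller than the cut weight of (V_s,V_t). -/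
open scoped Classical
open Finset

noncomputable section

/-- Moving `a` across a cut replaces the edges into `a` by the edges out of `a`. -/
theorem sum_cut_insert {α : Type*} [Fintype α] [DecidableEq α] (f : α → α → ℕ)
    {S : Finset α} {a : α} (ha : a ∉ S) :
    (∑ x ∈ insert a S, ∑ y ∈ (insert a S)ᶜ, f x y) + ∑ x ∈ S, f x a =
      (∑ x ∈ S, ∑ y ∈ Sᶜ, f x y) + ∑ y ∈ (insert a S)ᶜ, f a y := by
  have h : Sᶜ = insert a (insert a S)ᶜ := by
    ext y
    by_cases hy : y = a <;> simp [hy, ha]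
  have h' : ∑ x ∈ S, ∑ y ∈ Sᶜ, f x y =
      ∑ x ∈ S, f x a + ∑ x ∈ S, ∑ y ∈ (insert a S)ᶜ, f x y := by
    rw [← sum_add_distrib]
    refine sum_congr rfl fun x _ => ?_
    rw [h, sum_insert (by simp)]
  rw [sum_insert ha, h']
  ring

/-- The edges of `G'` from a vertex `v` of `G` to a set avoiding `s` have total weight at
most `deg v + 1`. -/
theorem sum_cliqueRedW_le {V : Type*} [Fintype V] [DecidableEq V] (G : SimpleGraph V)
    [DecidableRel G.Adj] (d : ℕ) (v : V) {T : Finset (V ⊕ Bool)} (hT : Sum.inr false ∉ T) :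
    (∑ y ∈ T, if cliqueRedAdj G (Sum.inl v) y then cliqueRedW d (Sum.inl v) y else 0) ≤
      G.degree v + 1 := by
  calc
    _ ≤ ∑ y ∈ T, Sum.elim (fun w => if G.Adj v w then 1 else 0)
          (fun b : Bool => if b then 1 else 0) y := by
      refine sum_le_sum fun y hy => ?_
      rcases y with w | b
      · simp [cliqueRedAdj, cliqueRedW]
      · cases b
        · exact absurd hy hT
        · simp [cliqueRedAdj, cliqueRedW]
    _ ≤ ∑ y, Sum.elim (fun w => if G.Adj v w then 1 else 0)
          (fun b : Bool => if b then 1 else 0) y :=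
      sum_le_sum_of_subset (subset_univ T)
    _ = G.degree v + 1 := by
      simp [Fintype.sum_sum_type, ← SimpleGraph.card_neighborFinset_eq_degree,
        SimpleGraph.neighborFinset_eq_filter]

theorem stmt15 {V : Type*} [Fintype V] [DecidableEq V] (G : SimpleGraph V)
    [DecidableRel G.Adj] (d ℓ : ℕ) (hℓ : 1 ≤ ℓ) (hd : ℓ < d)
    (hreg : ∀ v : V, G.degree v = d)
    (Vs : Finset (V ⊕ Bool))
    (hs : Sum.inr false ∈ Vs) (ht : Sum.inr true ∉ Vs)
    (v : V) (hv : Sum.inl v ∉ Vs) :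
    cliqueRedCutWeight G d (insert (Sum.inl v) Vs) < cliqueRedCutWeight G d Vs := by
  have hcut := sum_cut_insert
    (fun x y => if cliqueRedAdj G x y then cliqueRedW d x y else 0) hv
  have hout := sum_cliqueRedW_le G d v (T := (insert (Sum.inl v) Vs)ᶜ) (by simp [hs])
  have hin : d + 2 ≤ ∑ x ∈ Vs,
      if cliqueRedAdj G x (Sum.inl v) then cliqueRedW d x (Sum.inl v) else 0 := by
    refine le_trans ?_ (single_le_sum (fun _ _ => Nat.zero_le _) hs)
    simp [cliqueRedAdj, cliqueRedW]
  rw [hreg v] at hout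
  unfold cliqueRedCutWeight
  omega
end
end

section
/- Let ℓ ≥ 1, let G be a d-regular finite simple undirected graph on n vertices with d > ℓ, and let G' with edge weights w be as in the clique-reduction construction. Then G contains a clique of ℓ vertices if and only if there exists a bipartition (V_s,V_t) of V(G') with s ∈ V_s, t ∈ V_t, |V_s| ≤ ℓ + 1, and cut weight at most n·(d+2) − ℓ². -/
open scoped Classical
open Finset

noncomputable section

theorem SimpleGraph.sum_card_adj_filter_add_compl {V : Type*} [Fintype V] [DecidableEq V]
    (G : SimpleGraph V) [DecidableRel G.Adj] {d : ℕ} (hreg : ∀ v : V, G.degree v = d)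
    (S : Finset V) :
    ∑ a ∈ S, #{b ∈ S | G.Adj a b} + ∑ a ∈ S, #{b ∈ Sᶜ | G.Adj a b} = #S * d := by
  rw [← sum_add_distrib, ← smul_eq_mul, ← sum_const]
  refine sum_congr rfl fun a _ => ?_
  rw [← hreg a, ← G.card_neighborFinset_eq_degree, G.neighborFinset_eq_filter,
    ← card_union_of_disjoint (disjoint_filter_filter disjoint_compl_right), ← filter_union,
    union_compl]

theorem cliqueRedCutWeight_disjSum {V : Type*} [Fintype V] [DecidableEq V]
    (G : SimpleGraph V) [DecidableRel G.Adj] {d : ℕ} (hreg : ∀ v : V, G.degree v = d)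
    (S : Finset V) :
    cliqueRedCutWeight G d (S.disjSum {false}) + #S + ∑ a ∈ S, #{b ∈ S | G.Adj a b}
      = Fintype.card V * (d + 2) := by
  have hcompl : (S.disjSum {false})ᶜ = Sᶜ.disjSum {true} := by
    ext (a | b) <;> simp
  have hcut : cliqueRedCutWeight G d (S.disjSum {false})
      = ∑ a ∈ S, #{b ∈ Sᶜ | G.Adj a b} + #S + #Sᶜ * (d + 2) := by
    simp only [cliqueRedCutWeight, hcompl, sum_disjSum, sum_singleton]
    simp [cliqueRedAdj, cliqueRedW, sum_add_distrib]
  have h := G.sum_card_adj_filter_add_compl hreg S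
  rw [hcut, ← S.card_add_card_compl]
  linarith

theorem SimpleGraph.card_adj_filter_lt {V : Type*} (G : SimpleGraph V) [DecidableRel G.Adj]
    {S : Finset V} {a : V} (ha : a ∈ S) : #{b ∈ S | G.Adj a b} < #S :=
  card_lt_card (filter_ssubset.2 ⟨a, ha, G.irrefl⟩)

theorem SimpleGraph.card_add_sum_card_adj_filter_le {V : Type*} (G : SimpleGraph V)
    [DecidableRel G.Adj] (S : Finset V) :
    #S + ∑ a ∈ S, #{b ∈ S | G.Adj a b} ≤ #S ^ 2 := by
  calc #S + ∑ a ∈ S, #{b ∈ S | G.Adj a b} = ∑ a ∈ S, (#{b ∈ S | G.Adj a b} + 1) := by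
        rw [sum_add_distrib, card_eq_sum_ones, add_comm]
    _ ≤ ∑ _a ∈ S, #S := sum_le_sum fun a ha => G.card_adj_filter_lt ha
    _ = #S ^ 2 := by rw [sum_const, smul_eq_mul, sq]

theorem SimpleGraph.isClique_iff_card_add_sum_card_adj_filter {V : Type*} (G : SimpleGraph V)
    [DecidableRel G.Adj] (S : Finset V) :
    G.IsClique (S : Set V) ↔ #S + ∑ a ∈ S, #{b ∈ S | G.Adj a b} = #S ^ 2 := by
  have hsum : #S + ∑ a ∈ S, #{b ∈ S | G.Adj a b} = ∑ a ∈ S, (#{b ∈ S | G.Adj a b} + 1) := by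
    rw [sum_add_distrib, card_eq_sum_ones, add_comm]
  have hsq : #S ^ 2 = ∑ _a ∈ S, #S := by rw [sum_const, smul_eq_mul, sq]
  rw [hsum, hsq, sum_eq_sum_iff_of_le fun a ha => G.card_adj_filter_lt ha]
  have hsub (a : V) : {b ∈ S | G.Adj a b} ⊆ S.erase a := fun b hb =>
    mem_erase.2 ⟨(mem_filter.1 hb).2.ne', (mem_filter.1 hb).1⟩
  constructor
  · intro h a ha
    rw [(hsub a).antisymm fun b hb => mem_filter.2 ⟨mem_of_mem_erase hb,
      h ha (mem_of_mem_erase hb) (ne_of_mem_erase hb).symm⟩, card_erase_add_one ha]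
  · intro h a ha b hb hab
    have heq := eq_of_subset_of_card_le (hsub a) (by
      have := h a ha
      have := card_erase_add_one (mem_coe.1 ha)
      omega)
    have hmem : b ∈ S.erase a := mem_erase.2 ⟨hab.symm, hb⟩
    rw [← heq] at hmem
    exact (mem_filter.1 hmem).2

theorem stmt16 {V : Type*} [Fintype V] [DecidableEq V] (G : SimpleGraph V)
    [DecidableRel G.Adj] (d ℓ : ℕ) (hℓ : 1 ≤ ℓ) (hd : ℓ < d)
    (hreg : ∀ v : V, G.degree v = d) :
    (∃ K : Finset V, G.IsClique (K : Set V) ∧ K.card = ℓ)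
    ↔
    (∃ Vs : Finset (V ⊕ Bool),
      Sum.inr false ∈ Vs ∧ Sum.inr true ∉ Vs ∧ Vs.card ≤ ℓ + 1 ∧
      (cliqueRedCutWeight G d Vs : ℤ) ≤ (Fintype.card V : ℤ) * (d + 2) - ℓ ^ 2) := by
  constructor
  · rintro ⟨K, hK, rfl⟩
    refine ⟨K.disjSum {false}, by simp, by simp, by simp, ?_⟩
    have hcut := cliqueRedCutWeight_disjSum G hreg K
    have hsq := (G.isClique_iff_card_add_sum_card_adj_filter K).1 hK
    zify at hcut hsq
    linarith
  · rintro ⟨Vs, hs, ht, hcard, hw⟩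
    obtain ⟨S, rfl⟩ : ∃ S : Finset V, Vs = S.disjSum {false} := by
      refine ⟨Vs.toLeft, ?_⟩
      ext (a | _ | _) <;> simp [hs, ht]
    have hcut := cliqueRedCutWeight_disjSum G hreg S
    have hle := G.card_add_sum_card_adj_filter_le S
    have hSℓ : #S ≤ ℓ := by simpa using hcard
    have hsq : ℓ ^ 2 ≤ #S + ∑ a ∈ S, #{b ∈ S | G.Adj a b} := by
      zify at hcut ⊢
      linarith
    have hS : #S = ℓ := hSℓ.antisymm ((Nat.pow_le_pow_iff_left two_ne_zero).1 (hsq.trans hle))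
    subst hS
    exact ⟨S, (G.isClique_iff_card_add_sum_card_adj_filter S).2 (hle.antisymm hsq), rfl⟩
end
end

section
/- In the size-bounded construction, let V_s ⊆ V(G) with s ∈ V_s, t ∉ V_s, and |V_s| ≤ ℓ, and define B[V_s] = V_s ∪ {a(v,u) : v ∈ V_s, (v,u) an arc of →G} ∪ ⋃_{v ∈ V_s ∖ {s}} J(v). Then |B[V_s]| = |V_s| + n + d·(|V_s| − 1) ≤ ℓ + n + d·(ℓ − 1). -/
open scoped Classical
open Finset

noncomputable section

/-- Subdivision vertices of `G'`: one vertex `a(v,u)` for each arc `(v,u)` of `→G`,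
the orientation of `G` from the `≺`-smaller to the `≺`-larger endpoint. -/
abbrev SBArc {V : Type*} (G : SimpleGraph V) [LinearOrder V] :=
  {p : V × V // G.Adj p.1 p.2 ∧ p.1 < p.2}

/-- The vertices of `⋃_{v ∈ V(G)∖{s,t}} J(v)`: for each `v ∈ V(G) ∖ {s,t}`, the set
`J(v)` has one vertex for every in-arc of `v` in `→G` (so `|J(v)|` equals the
in-degree of `v` in `→G`). -/
abbrev SBJ {V : Type*} (G : SimpleGraph V) [LinearOrder V] (s t : V) :=
  {p : V × V // (G.Adj p.1 p.2 ∧ p.1 < p.2) ∧ p.2 ≠ s ∧ p.2 ≠ t}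

/-- Vertices of `G''`. -/
abbrev SBV {V : Type*} (G : SimpleGraph V) [LinearOrder V] (s t : V) :=
  (V ⊕ SBArc G) ⊕ SBJ G s t

/-- Arcs of `G''`: `(v, a(v,u))` and `(a(v,u), u)` for every arc `(v,u)` of `→G`,
together with an arc from `v` to every vertex of `J(v)`. -/
def sbArcRel {V : Type*} (G : SimpleGraph V) [LinearOrder V] (s t : V) :
    SBV G s t → SBV G s t → Prop
  | Sum.inl (Sum.inl v), Sum.inl (Sum.inr a) => a.1.1 = v
  | Sum.inl (Sum.inr a), Sum.inl (Sum.inl u) => a.1.2 = u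
  | Sum.inl (Sum.inl v), Sum.inr j => j.1.2 = v
  | _, _ => False

theorem sum_univ_subtype_prod_ite {V : Type*} [Fintype V] (q r : V × V → Prop) [DecidablePred r]
    [Fintype {p : V × V // q p}] :
    (∑ a : {p : V × V // q p}, if r a.1 then 1 else 0)
      = ∑ v : V, ∑ u : V, if q (v, u) ∧ r (v, u) then 1 else 0 := by
  rw [← Fintype.sum_prod_type' (f := fun v u => if q (v, u) ∧ r (v, u) then 1 else 0),
    ← Finset.sum_subtype (Finset.univ.filter q) (by simp) (fun p => if r p then 1 else 0),
    Finset.sum_filter]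
  refine Finset.sum_congr rfl fun p _ => ?_
  by_cases h : q p <;> simp [h]

/-- Every vertex's degree is the sum of its out-degree and its in-degree in the orientation of
the graph along a linear order. -/
theorem sum_out_add_sum_in_eq_degree {V : Type*} [Fintype V] [LinearOrder V] (G : SimpleGraph V)
    [DecidableRel G.Adj] (v : V) :
    (∑ u : V, if G.Adj v u ∧ v < u then 1 else 0) + (∑ u : V, if G.Adj u v ∧ u < v then 1 else 0)
      = G.degree v := by
  rw [← G.card_neighborFinset_eq_degree, G.neighborFinset_eq_filter, Finset.card_filter,
    ← Finset.sum_add_distrib]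
  refine Finset.sum_congr rfl fun u _ => ?_
  by_cases h : G.Adj v u
  · rcases lt_or_gt_of_ne h.ne with hlt | hlt <;> simp [h, h.symm, hlt, hlt.not_gt]
  · simp [h, G.adj_comm u v]

theorem stmt17 {V : Type*} [Fintype V] [LinearOrder V] (G : SimpleGraph V)
    [DecidableRel G.Adj] (s t : V) (hst : s ≠ t)
    (hmin : ∀ v, s ≤ v) (hmax : ∀ v, v ≤ t)
    (hnadj : ¬ G.Adj s t)
    (hsadj : ∀ v, v ≠ s → v ≠ t → G.Adj s v)
    (htadj : ∀ v, v ≠ s → v ≠ t → G.Adj t v)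
    (d : ℕ) (hdeg : ∀ v, v ≠ s → v ≠ t → G.degree v = d)
    (ℓ : ℕ) (hℓ : 1 ≤ ℓ)
    (Vs : Finset V) (hsV : s ∈ Vs) (htV : t ∉ Vs) (hcard : Vs.card ≤ ℓ) :
    -- B[V_s] = V_s ∪ {a(v,u) : v ∈ V_s, (v,u) an arc of →G} ∪ ⋃_{v ∈ V_s ∖ {s}} J(v)
    (Finset.univ.filter (fun x : SBV G s t => match x with
      | Sum.inl (Sum.inl v) => v ∈ Vs
      | Sum.inl (Sum.inr a) => a.1.1 ∈ Vs
      | Sum.inr j => j.1.2 ∈ Vs ∧ j.1.2 ≠ s)).card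
      = Vs.card + (Finset.univ.filter (fun v : V => v ≠ s ∧ v ≠ t)).card
          + d * (Vs.card - 1)
    ∧
    (Finset.univ.filter (fun x : SBV G s t => match x with
      | Sum.inl (Sum.inl v) => v ∈ Vs
      | Sum.inl (Sum.inr a) => a.1.1 ∈ Vs
      | Sum.inr j => j.1.2 ∈ Vs ∧ j.1.2 ≠ s)).card
      ≤ ℓ + (Finset.univ.filter (fun v : V => v ≠ s ∧ v ≠ t)).card + d * (ℓ - 1) := by
  have key : (Finset.univ.filter (fun x : SBV G s t => match x with
      | Sum.inl (Sum.inl v) => v ∈ Vs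
      | Sum.inl (Sum.inr a) => a.1.1 ∈ Vs
      | Sum.inr j => j.1.2 ∈ Vs ∧ j.1.2 ≠ s)).card
      = Vs.card + (Finset.univ.filter (fun v : V => v ≠ s ∧ v ≠ t)).card
          + d * (Vs.card - 1) := by
    have hout : (∑ a : SBArc G, if a.1.1 ∈ Vs then 1 else 0)
        = ∑ v ∈ Vs, ∑ u : V, if G.Adj v u ∧ v < u then 1 else 0 := by
      rw [sum_univ_subtype_prod_ite (fun p => G.Adj p.1 p.2 ∧ p.1 < p.2) (fun p => p.1 ∈ Vs),
        ← Finset.sum_subset (Finset.subset_univ Vs)]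
      · refine Finset.sum_congr rfl fun v hv => ?_
        simp [hv]
      · intro v _ hv
        simp [hv]
    have hin : (∑ j : SBJ G s t, if j.1.2 ∈ Vs ∧ j.1.2 ≠ s then 1 else 0)
        = ∑ v ∈ Vs.erase s, ∑ u : V, if G.Adj u v ∧ u < v then 1 else 0 := by
      rw [sum_univ_subtype_prod_ite
          (fun p => (G.Adj p.1 p.2 ∧ p.1 < p.2) ∧ p.2 ≠ s ∧ p.2 ≠ t)
          (fun p => p.2 ∈ Vs ∧ p.2 ≠ s),
        Finset.sum_comm, ← Finset.sum_subset (Finset.subset_univ (Vs.erase s))]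
      · refine Finset.sum_congr rfl fun v hv => ?_
        obtain ⟨hvs, hv⟩ := Finset.mem_erase.mp hv
        have hvt : v ≠ t := ne_of_mem_of_not_mem hv htV
        simp [hv, hvs, hvt]
      · intro v _ hv
        refine Finset.sum_eq_zero fun u _ => if_neg ?_
        rintro ⟨-, hvV, hvs⟩
        exact hv (Finset.mem_erase.mpr ⟨hvs, hvV⟩)
    have hs : (∑ u : V, if G.Adj s u ∧ s < u then 1 else 0)
        = (Finset.univ.filter (fun v : V => v ≠ s ∧ v ≠ t)).card := by
      rw [Finset.card_filter]
      refine Finset.sum_congr rfl fun u _ => ?_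
      have hiff : (G.Adj s u ∧ s < u) ↔ (u ≠ s ∧ u ≠ t) := by
        refine ⟨fun h => ⟨h.2.ne', ?_⟩, fun h => ⟨hsadj u h.1 h.2, (hmin u).lt_of_ne' h.1⟩⟩
        rintro rfl
        exact hnadj h.1
      simp only [hiff]
    have hd : (∑ v ∈ Vs.erase s, ∑ u : V, if G.Adj v u ∧ v < u then 1 else 0)
        + (∑ v ∈ Vs.erase s, ∑ u : V, if G.Adj u v ∧ u < v then 1 else 0)
        = d * (Vs.card - 1) := by
      rw [← Finset.sum_add_distrib, ← Finset.card_erase_of_mem hsV, mul_comm, ← smul_eq_mul,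
        ← Finset.sum_const]
      refine Finset.sum_congr rfl fun v hv => ?_
      obtain ⟨hvs, hv⟩ := Finset.mem_erase.mp hv
      rw [← hdeg v hvs (ne_of_mem_of_not_mem hv htV)]
      exact sum_out_add_sum_in_eq_degree G v
    have hV : (∑ v : V, if v ∈ Vs then 1 else 0) = Vs.card := by simp
    rw [← Finset.add_sum_erase Vs _ hsV, hs] at hout
    rw [Finset.card_filter, Fintype.sum_sum_type, Fintype.sum_sum_type]
    calc _ = (∑ v : V, if v ∈ Vs then 1 else 0) + (∑ a : SBArc G, if a.1.1 ∈ Vs then 1 else 0)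
          + (∑ j : SBJ G s t, if j.1.2 ∈ Vs ∧ j.1.2 ≠ s then 1 else 0) := by
          congr!
      _ = _ := by rw [hV, hout, hin, ← hd]; ring
  refine ⟨key, key.trans_le ?_⟩
  gcongr
end
end
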